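/- arXiv:math/0305319 — 11 statements merged into one kernel-verified Lean document; each statement's English description precedes it below -/
import Mathlib

section
/- Let a = (a_0, a_1, ..., a_n) be an admissible sequence. Then either δa = a (a is self-describing) or a < δa in the lexicographic order. -/
/-- The transformation `δ`: `(δa)_i = #{ j | j < i ∧ a_j < a_i }`. -/
def delta {N : ℕ} (a : Fin N → ℕ) : Fin N → ℕ :=
  fun i => (Finset.univ.filter (fun j => j < i ∧ a j < a i)).card

/-- For every admissible sequence `a = (a_0, …, a_n)`
(i.e. `a_i ≤ i` for all `i`), either `δa = a` or `a < δa` lexicographically. -/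
theorem stmt1 (n : ℕ) (a : Fin (n + 1) → ℕ) (ha : ∀ i : Fin (n + 1), a i ≤ i) :
    delta a = a ∨ ∃ i, a i < delta a i ∧ ∀ j, j < i → a j = delta a j := by
  have key : ∀ i, a i ≤ delta a i := by
    intro i
    have hi := ha i
    have h : (Finset.univ : Finset (Fin (a i))).card ≤ delta a i := by
      unfold delta
      apply Finset.card_le_card_of_injOn
        (fun k : Fin (a i) => (⟨k.1, by have := k.2; have := i.2; omega⟩ : Fin (n + 1)))
      · intro k _
        have h1 := ha ⟨k.1, by have := k.2; have := i.2; omega⟩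
        have h2 := k.2
        simp only [Finset.coe_filter, Finset.mem_univ, true_and, Set.mem_setOf_eq, Fin.lt_def]
        simp only at h1
        constructor <;> omega
      · intro x _ y _ hxy
        simpa [Fin.ext_iff] using hxy
    simpa using h
  by_cases hne : delta a = a
  · exact Or.inl hne
  · right
    have hex : ∃ i, a i ≠ delta a i := by
      by_contra hc
      push Not at hc
      exact hne (funext fun i => (hc i).symm)
    obtain ⟨i, hi, hmin⟩ := WellFounded.has_min
      (wellFounded_lt : WellFounded ((· < ·) : Fin (n + 1) → Fin (n + 1) → Prop))
      {i | a i ≠ delta a i} hex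
    refine ⟨i, lt_of_le_of_ne (key i) hi, fun j hj => ?_⟩
    by_contra hc
    exact hmin j hc hj
end

section
/- For every admissible sequence a = (a_0, a_1, ..., a_n), the sequence obtained by applying δ repeatedly n(n+1)/2 times to a is self-describing, i.e., δ^{n(n+1)/2} a is a fixed point of δ. -/
theorem delta_le_index {N : ℕ} (a : Fin N → ℕ) (i : Fin N) : delta a i ≤ i := by
  unfold delta
  calc _ ≤ (Finset.Iio i).card := Finset.card_le_card (fun j hj => by
        simp only [Finset.mem_filter, Finset.mem_univ, true_and] at hj
        simpa using hj.1)
    _ = i := by simp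

theorem le_delta {N : ℕ} (a : Fin N → ℕ) (ha : ∀ i : Fin N, a i ≤ i) (i : Fin N) :
    a i ≤ delta a i := by
  unfold delta
  have hlt : a i < N := lt_of_le_of_lt (ha i) i.2
  calc a i = (Finset.Iio (⟨a i, hlt⟩ : Fin N)).card := by simp
    _ ≤ _ := Finset.card_le_card (fun j hj => by
        have hj' : (j : ℕ) < a i := by simpa [Fin.lt_def] using hj
        have h1 := ha i
        have h2 := ha j
        simp only [Finset.mem_filter, Finset.mem_univ, true_and, Fin.lt_def]
        omega)

theorem sum_lt_delta {N : ℕ} (a : Fin N → ℕ) (ha : ∀ i : Fin N, a i ≤ i)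
    (h : delta a ≠ a) : ∑ i, a i < ∑ i, delta a i := by
  obtain ⟨i, hi⟩ := Function.ne_iff.mp h
  exact Finset.sum_lt_sum (fun i _ => le_delta a ha i)
    ⟨i, Finset.mem_univ _, lt_of_le_of_ne (le_delta a ha i) (Ne.symm hi)⟩

theorem delta_iter {N : ℕ} (a : Fin N → ℕ) (ha : ∀ i : Fin N, a i ≤ i) (k : ℕ) :
    (∀ i : Fin N, (delta^[k] a) i ≤ i) ∧
      (delta (delta^[k] a) = delta^[k] a ∨ k ≤ ∑ i, (delta^[k] a) i) := by
  induction k with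
  | zero => exact ⟨ha, Or.inr (Nat.zero_le _)⟩
  | succ k ih =>
    rw [Function.iterate_succ_apply']
    refine ⟨delta_le_index _, ?_⟩
    by_cases h : delta (delta^[k] a) = delta^[k] a
    · left; rw [h, h]
    · right
      have h1 := sum_lt_delta _ ih.1 h
      have h2 := ih.2.resolve_left h
      omega

/-- For every admissible sequence `a = (a_0, …, a_n)`,
the sequence `δ^[n(n+1)/2] a` is self-describing, i.e. a fixed point of `δ`. -/
theorem stmt2 (n : ℕ) (a : Fin (n + 1) → ℕ) (ha : ∀ i : Fin (n + 1), a i ≤ i) :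
    delta (delta^[n * (n + 1) / 2] a) = delta^[n * (n + 1) / 2] a := by
  obtain ⟨h1, h2⟩ := delta_iter a ha (n * (n + 1) / 2)
  by_contra h
  have h3 := sum_lt_delta _ h1 h
  have h4 := h2.resolve_left h
  have h5 : ∑ i, delta (delta^[n * (n + 1) / 2] a) i ≤ ∑ i : Fin (n + 1), (i : ℕ) :=
    Finset.sum_le_sum (fun i _ => delta_le_index _ i)
  rw [Fin.sum_univ_eq_sum_range (fun i => i) (n + 1), Finset.sum_range_id,
    Nat.add_sub_cancel, Nat.mul_comm (n + 1) n] at h5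
  omega
end

section
/- The number of self-describing sequences of length n+1 (i.e., sequences (a_0, a_1, ..., a_n) of natural numbers with δa = a) is equal to the (n+1)-st Catalan number c_{n+1}. -/
/-- Number of entries of `a` smaller than `y`. -/
def cntF {N : ℕ} (a : Fin N → ℕ) (y : ℕ) : ℕ :=
  (Finset.univ.filter (fun j => a j < y)).card

/-- The admissible values for the next entry. -/
def nextS {N : ℕ} (a : Fin N → ℕ) : Finset ℕ :=
  (Finset.range (N + 1)).filter (fun y => cntF a y = y)

/-- Glue a last entry. -/
def snocN {N : ℕ} (a : Fin N → ℕ) (x : ℕ) : Fin (N + 1) → ℕ :=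
  Fin.snoc (α := fun _ => ℕ) a x

lemma cntF_le {N : ℕ} (a : Fin N → ℕ) (y : ℕ) : cntF a y ≤ N := by
  unfold cntF
  exact (Finset.card_filter_le _ _).trans (by simp)

lemma cntF_snoc {N : ℕ} (a : Fin N → ℕ) (x y : ℕ) :
    cntF (snocN a x) y = cntF a y + if x < y then 1 else 0 := by
  unfold cntF snocN
  rw [Finset.card_filter, Finset.card_filter, Fin.sum_univ_castSucc]
  simp

lemma delta_snoc {N : ℕ} (a : Fin N → ℕ) (x : ℕ) :
    delta (snocN a x) = snocN (delta a) (cntF a x) := by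
  funext i
  refine Fin.lastCases ?_ (fun i => ?_) i
  · unfold delta cntF snocN
    rw [Finset.card_filter, Fin.sum_univ_castSucc]
    simp [Fin.castSucc_lt_last]
  · unfold delta snocN
    rw [Finset.card_filter, Fin.sum_univ_castSucc]
    simp [not_lt.2 (Fin.le_last i.castSucc)]

lemma snocN_inj {N : ℕ} {a b : Fin N → ℕ} {x y : ℕ} :
    snocN a x = snocN b y ↔ a = b ∧ x = y := by
  constructor
  · intro h
    refine ⟨?_, ?_⟩
    · funext i
      have := congrFun h i.castSucc
      simpa [snocN] using this
    · have := congrFun h (Fin.last N)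
      simpa [snocN] using this
  · rintro ⟨rfl, rfl⟩; rfl

/-- The self-describing sequences, built recursively. -/
def seqA : (N : ℕ) → Finset (Fin N → ℕ)
  | 0 => Finset.univ
  | N + 1 => ((seqA N).sigma (fun a => nextS a)).image (fun p => snocN p.1 p.2)

lemma mem_seqA {N : ℕ} (a : Fin N → ℕ) : a ∈ seqA N ↔ delta a = a := by
  induction N with
  | zero => exact ⟨fun _ => Subsingleton.elim _ _, fun _ => Finset.mem_univ _⟩
  | succ N ih =>
    obtain ⟨b, x, rfl⟩ : ∃ b x, a = snocN b x :=
      ⟨Fin.init a, a (Fin.last N), (Fin.snoc_init_self a).symm⟩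
    rw [delta_snoc, snocN_inj, ← ih]
    simp only [seqA, Finset.mem_image, Finset.mem_sigma, Sigma.exists, snocN_inj]
    constructor
    · rintro ⟨c, y, ⟨h1, h2⟩, rfl, rfl⟩
      exact ⟨h1, (Finset.mem_filter.1 h2).2⟩
    · rintro ⟨h1, h2⟩
      refine ⟨b, x, ⟨h1, ?_⟩, rfl, rfl⟩
      have := cntF_le b x
      simp only [nextS, Finset.mem_filter, Finset.mem_range]
      omega

lemma cntF_ge {N : ℕ} (a : Fin N → ℕ) (ha : a ∈ seqA N) (y : ℕ) : min y N ≤ cntF a y := by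
  induction N with
  | zero => simp
  | succ N ih =>
    simp only [seqA, Finset.mem_image, Finset.mem_sigma, Sigma.exists] at ha
    obtain ⟨b, x, ⟨hb, hx⟩, rfl⟩ := ha
    have h1 := ih b hb
    simp only [nextS, Finset.mem_filter, Finset.mem_range] at hx
    rw [cntF_snoc]
    split_ifs <;> omega

lemma nextS_snoc {N : ℕ} (a : Fin N → ℕ) (ha : a ∈ seqA N) (x : ℕ) (hx : x ∈ nextS a) :
    nextS (snocN a x) = insert (N + 1) ((nextS a).filter (fun y => y ≤ x)) := by
  ext y
  simp only [nextS, Finset.mem_filter, Finset.mem_range, Finset.mem_insert, cntF_snoc] at hx ⊢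
  have h1 := cntF_ge a ha y
  have h2 := cntF_le a y
  split_ifs <;> omega

lemma card_nextS_snoc {N : ℕ} (a : Fin N → ℕ) (ha : a ∈ seqA N) (x : ℕ) (hx : x ∈ nextS a) :
    (nextS (snocN a x)).card = ((nextS a).filter (fun y => y ≤ x)).card + 1 := by
  rw [nextS_snoc a ha x hx, Finset.card_insert_of_notMem]
  simp [nextS]

lemma sum_rank (g : ℕ → ℕ) (S : Finset ℕ) :
    ∑ x ∈ S, g (S.filter (fun y => y ≤ x)).card = ∑ j ∈ Finset.range S.card, g (j + 1) := by
  induction S using Finset.induction_on_max with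
  | empty => simp
  | insert m S hm ih =>
    have hmS : m ∉ S := fun h => lt_irrefl _ (hm m h)
    rw [Finset.sum_insert hmS, Finset.card_insert_of_notMem hmS, Finset.sum_range_succ, ← ih,
      add_comm]
    congr 1
    · refine Finset.sum_congr rfl fun x hx => ?_
      rw [Finset.filter_insert, if_neg (not_le.2 (hm x hx))]
    · rw [Finset.filter_true_of_mem, Finset.card_insert_of_notMem hmS]
      intro x hx
      rcases Finset.mem_insert.1 hx with rfl | h
      · exact le_rfl
      · exact (hm x h).le

/-- Number of `m`-step extensions of a node with `k` children in the Catalan tree. -/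
def extf : ℕ → ℕ → ℕ
  | 0, _ => 1
  | m + 1, k => ∑ j ∈ Finset.range k, extf m (j + 2)

lemma sum_seqA (N m : ℕ) : ∑ a ∈ seqA N, extf m (nextS a).card = extf (N + m) 1 := by
  induction N generalizing m with
  | zero =>
    have : ∀ a : Fin 0 → ℕ, (nextS a).card = 1 := by
      intro a
      simp [nextS, cntF, Finset.filter_singleton]
    simp [seqA, this]
  | succ N ih =>
    rw [seqA, Finset.sum_image, Finset.sum_sigma, show N + 1 + m = N + (m + 1) by ring, ← ih]
    · refine Finset.sum_congr rfl fun a ha => ?_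
      rw [extf, ← sum_rank (fun j => extf m (j + 1))]
      refine Finset.sum_congr rfl fun x hx => ?_
      simp only
      rw [card_nextS_snoc a ha x hx]
    · rintro ⟨a, x⟩ _ ⟨b, y⟩ _ h
      obtain ⟨rfl, rfl⟩ := snocN_inj.1 h
      rfl

lemma extf_closed (m k : ℕ) :
    extf (m + 1) k + (2 * m + k + 1).choose m = (2 * m + k + 1).choose (m + 1) := by
  induction m generalizing k with
  | zero => simp [extf]
  | succ m ih =>
    induction k with
    | zero =>
      have := Nat.choose_symm_half (m + 1)
      simpa [extf] using this.symm
    | succ k ihk =>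
      have h1 := ih (k + 2)
      have h2 : extf (m + 1 + 1) (k + 1) = extf (m + 1 + 1) k + extf (m + 1) (k + 2) := by
        simp only [extf, Finset.sum_range_succ]
      have e1 : 2 * (m + 1) + (k + 1) + 1 = (2 * m + k + 3) + 1 := by ring
      have e2 : 2 * (m + 1) + k + 1 = 2 * m + k + 3 := by ring
      have e3 : 2 * m + (k + 2) + 1 = 2 * m + k + 3 := by ring
      rw [e2] at ihk
      rw [e3] at h1
      rw [e1, h2, Nat.choose_succ_succ' _ m, Nat.choose_succ_succ' _ (m + 1)]
      omega

lemma extf_catalan (n : ℕ) : extf (n + 1) 1 = catalan (n + 1) := by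
  have h1 := extf_closed n 1
  have h2 := succ_mul_catalan_eq_centralBinom (n + 1)
  have h3 := Nat.choose_succ_right_eq (2 * n + 1 + 1) n
  rw [show 2 * n + 1 + 1 - n = n + 2 by omega] at h3
  rw [Nat.centralBinom, show 2 * (n + 1) = 2 * n + 1 + 1 by ring] at h2
  have : (n + 2) * extf (n + 1) 1 = (n + 2) * catalan (n + 1) := by nlinarith
  exact Nat.eq_of_mul_eq_mul_left (by omega) this

/-- The number of self-describing sequences of length `n+1`
(i.e. sequences `(a_0, …, a_n)` of natural numbers with `δa = a`) is the
`(n+1)`-st Catalan number. -/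
theorem stmt4 (n : ℕ) :
    Nat.card {a : Fin (n + 1) → ℕ // delta a = a} = catalan (n + 1) := by
  have h := sum_seqA (n + 1) 0
  have h0 : ∀ k, extf 0 k = 1 := fun k => by simp only [extf]
  simp only [h0, Finset.sum_const, smul_eq_mul, mul_one, Nat.add_zero] at h
  rw [← extf_catalan, ← h, ← Nat.card_eq_finsetCard]
  exact Nat.card_congr (Equiv.subtypeEquivRight fun a => (mem_seqA a).symm)
end

section
/- For every n and every r with 0 ≤ r ≤ n, the number of self-describing sequences (a_0, a_1, ..., a_n) of length n+1 whose last term satisfies a_n = r is equal to c_r · c_{n−r}, the product of the r-th and (n−r)-th Catalan numbers. -/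
/-- cumulative counting function of a sequence -/
def cum {N : ℕ} (a : Fin N → ℕ) (s : ℕ) : ℕ :=
  (Finset.univ.filter (fun j => a j < s)).card

/-- Dyck-like cumulative functions -/
def IsF (m : ℕ) (f : ℕ → ℕ) : Prop :=
  Monotone f ∧ f 0 = 0 ∧ (∀ s, s ≤ m → s ≤ f s) ∧ ∀ s, m ≤ s → f s = m

/-- Dyck-like functions with last fixed point `r` -/
def IsG (n r : ℕ) (f : ℕ → ℕ) : Prop :=
  IsF (n + 1) f ∧ r ≤ n ∧ f r = r ∧ ∀ s, r < s → s ≤ n → s < f s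

theorem cum_succ {n : ℕ} (a : Fin (n + 1) → ℕ) (s : ℕ) :
    cum a s = cum (fun i : Fin n => a i.castSucc) s + if a (Fin.last n) < s then 1 else 0 := by
  simp only [cum, Finset.card_filter, Fin.sum_univ_castSucc]

theorem delta_castSucc {n : ℕ} (a : Fin (n + 1) → ℕ) (i : Fin n) :
    delta a i.castSucc = delta (fun i : Fin n => a i.castSucc) i := by
  have h : ¬ (Fin.last n < i.castSucc) := by
    exact not_lt.mpr (Fin.le_last _)
  simp [delta, Finset.card_filter, Fin.sum_univ_castSucc, h, -Finset.sum_boole]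

theorem delta_last {n : ℕ} (a : Fin (n + 1) → ℕ) :
    delta a (Fin.last n) = cum (fun i : Fin n => a i.castSucc) (a (Fin.last n)) := by
  simp [delta, cum, Finset.card_filter, Fin.sum_univ_castSucc, Fin.castSucc_lt_last, -Finset.sum_boole]

theorem sd_succ {n : ℕ} (a : Fin (n + 1) → ℕ) :
    delta a = a ↔ delta (fun i : Fin n => a i.castSucc) = (fun i : Fin n => a i.castSucc) ∧
      cum (fun i : Fin n => a i.castSucc) (a (Fin.last n)) = a (Fin.last n) := by
  constructor
  · intro h
    refine ⟨?_, ?_⟩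
    · funext i
      rw [← delta_castSucc, h]
    · rw [← delta_last, h]
  · rintro ⟨h1, h2⟩
    funext i
    refine Fin.lastCases ?_ (fun i => ?_) i
    · rw [delta_last, h2]
    · rw [delta_castSucc, h1]

theorem isG_step {n r : ℕ} {f g : ℕ → ℕ} (hg : IsF n g) (hr : g r = r)
    (hf : ∀ s, f s = g s + if r < s then 1 else 0) : IsG n r f := by
  obtain ⟨h1, h2, h3, h4⟩ := hg
  have hrn : r ≤ n := by
    by_contra hc
    have := h4 r (by omega)
    omega
  refine ⟨⟨?_, ?_, ?_, ?_⟩, hrn, ?_, ?_⟩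
  · intro x y hxy
    have := h1 hxy
    rw [hf, hf]; split_ifs <;> omega
  · rw [hf, h2]; simp
  · intro s hs
    rw [hf]
    rcases Nat.lt_or_ge n s with h | h
    · have := h4 s h.le
      rw [if_pos (by omega)]; omega
    · have := h3 s h
      omega
  · intro s hs
    rw [hf, h4 s (by omega), if_pos (by omega)]
  · rw [hf, hr]; simp
  · intro s h5 h6
    have := h3 s h6
    rw [hf, if_pos h5]; omega

theorem isG_unstep {n r : ℕ} {f : ℕ → ℕ} (hf : IsG n r f) :
    ∃ g, IsF n g ∧ g r = r ∧ ∀ s, f s = g s + if r < s then 1 else 0 := by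
  obtain ⟨⟨h1, h2, h3, h4⟩, hrn, hr, h5⟩ := hf
  have key : ∀ s, r < s → r + 1 ≤ f s := by
    intro s hs
    have := h1 (show r + 1 ≤ s from hs)
    have := h3 (r + 1) (by omega)
    omega
  refine ⟨fun s => if r < s then f s - 1 else f s, ⟨?_, ?_, ?_, ?_⟩, ?_, ?_⟩
  · intro x y hxy
    have := h1 hxy
    dsimp only
    split_ifs with ha hb hb
    · omega
    · omega
    · have := key y hb
      have := h1 (show x ≤ r by omega)
      omega
    · omega
  · simp [h2]
  · intro s hs
    dsimp only
    split_ifs with ha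
    · have := h5 s ha hs
      omega
    · exact h3 s (by omega)
  · intro s hs
    dsimp only
    split_ifs with ha
    · rcases Nat.lt_or_ge n s with h | h
      · rw [h4 s h]; omega
      · have hsn : s = n := by omega
        subst hsn
        have := h5 s ha le_rfl
        have := h1 (show s ≤ s + 1 by omega)
        have := h4 (s + 1) le_rfl
        omega
    · have : s = r := by omega
      subst this
      omega
  · simp [hr]
  · intro s
    dsimp only
    split_ifs with ha
    · have := key s ha
      omega
    · rfl

theorem exists_isG {n : ℕ} {f : ℕ → ℕ} (hf : IsF (n + 1) f) : ∃ r, IsG n r f := by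
  have h0 : f 0 = 0 := hf.2.1
  refine ⟨Nat.findGreatest (fun r => f r = r) n, hf, Nat.findGreatest_le n, ?_, ?_⟩
  · exact Nat.findGreatest_spec (P := fun r => f r = r) (Nat.zero_le n) h0
  · intro s h1 h2
    have h3 := Nat.findGreatest_is_greatest (P := fun r => f r = r) h1 h2
    have := hf.2.2.1 s (by omega)
    omega

theorem isG_unique {n r r' : ℕ} {f : ℕ → ℕ} (h : IsG n r f) (h' : IsG n r' f) : r = r' := by
  obtain ⟨_, h1, h2, h3⟩ := h
  obtain ⟨_, h1', h2', h3'⟩ := h'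
  rcases lt_trichotomy r r' with h | h | h
  · have := h3 r' h h1'
    omega
  · exact h
  · have := h3' r h h1
    omega

theorem isF_zero {f : ℕ → ℕ} : IsF 0 f ↔ f = fun _ => 0 := by
  constructor
  · intro h
    funext s
    exact h.2.2.2 s (Nat.zero_le _)
  · rintro rfl
    exact ⟨fun _ _ _ => le_rfl, rfl, fun s hs => hs, fun _ _ => rfl⟩

theorem isF_cum {m : ℕ} (a : Fin m → ℕ) (h : delta a = a) : IsF m (cum a) := by
  induction m with
  | zero => rw [isF_zero]; funext s; simp [cum]
  | succ n ih =>
    obtain ⟨h1, h2⟩ := (sd_succ a).1 h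
    exact (isG_step (ih _ h1) h2 (cum_succ a)).1

theorem isG_cum {n : ℕ} (a : Fin (n + 1) → ℕ) (h : delta a = a) :
    IsG n (a (Fin.last n)) (cum a) := by
  obtain ⟨h1, h2⟩ := (sd_succ a).1 h
  exact isG_step (isF_cum _ h1) h2 (cum_succ a)

theorem cum_inj {m : ℕ} (a b : Fin m → ℕ) (ha : delta a = a) (hb : delta b = b)
    (h : cum a = cum b) : a = b := by
  induction m with
  | zero => exact Subsingleton.elim _ _
  | succ n ih =>
    have hl : a (Fin.last n) = b (Fin.last n) :=
      isG_unique (isG_cum a ha) (h ▸ isG_cum b hb)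
    have hi := ih _ _ ((sd_succ a).1 ha).1 ((sd_succ b).1 hb).1 (by
      funext s
      have := congrFun h s
      rw [cum_succ, cum_succ, hl] at this
      omega)
    funext i
    refine Fin.lastCases hl (fun i => ?_) i
    exact congrFun hi i

theorem cum_surj {m : ℕ} (f : ℕ → ℕ) (hf : IsF m f) :
    ∃ a : Fin m → ℕ, delta a = a ∧ cum a = f := by
  induction m generalizing f with
  | zero =>
    rw [isF_zero] at hf
    subst hf
    exact ⟨fun _ => 0, Subsingleton.elim _ _, by funext s; simp [cum]⟩
  | succ n ih =>
    obtain ⟨r, hr⟩ := exists_isG hf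
    obtain ⟨g, hg, hgr, hgf⟩ := isG_unstep hr
    obtain ⟨a, ha, hag⟩ := ih g hg
    refine ⟨Fin.snoc (α := fun _ => ℕ) a r, ?_, ?_⟩
    · rw [sd_succ]
      simp [ha, hag, hgr]
    · funext s
      rw [cum_succ, hgf]
      simp [hag]

theorem card_sd (m : ℕ) :
    Nat.card {a : Fin m → ℕ // delta a = a} = Nat.card {f : ℕ → ℕ // IsF m f} := by
  refine Nat.card_congr (Equiv.ofBijective (fun a => ⟨cum a.1, isF_cum a.1 a.2⟩) ⟨?_, ?_⟩)
  · intro a b h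
    exact Subtype.ext (cum_inj _ _ a.2 b.2 (congrArg Subtype.val h))
  · rintro ⟨f, hf⟩
    obtain ⟨a, ha, h⟩ := cum_surj f hf
    exact ⟨⟨a, ha⟩, Subtype.ext h⟩

theorem card_sd_last (n r : ℕ) :
    Nat.card {a : Fin (n + 1) → ℕ // delta a = a ∧ a (Fin.last n) = r} =
      Nat.card {f : ℕ → ℕ // IsG n r f} := by
  refine Nat.card_congr (Equiv.ofBijective
    (fun a => ⟨cum a.1, by
      have h := isG_cum a.1 a.2.1
      rw [a.2.2] at h
      exact h⟩) ⟨?_, ?_⟩)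
  · intro a b h
    exact Subtype.ext (cum_inj _ _ a.2.1 b.2.1 (congrArg Subtype.val h))
  · rintro ⟨f, hf⟩
    obtain ⟨a, ha, h⟩ := cum_surj f hf.1
    refine ⟨⟨a, ha, ?_⟩, Subtype.ext h⟩
    subst h
    exact isG_unique (isG_cum a ha) hf

theorem isF_left {r k : ℕ} {f : ℕ → ℕ} (hf : IsG (r + k) r f) :
    IsF r (fun s => f (min s r)) := by
  obtain ⟨⟨h1, h2, h3, h4⟩, hrn, hr, h5⟩ := hf
  refine ⟨?_, ?_, ?_, ?_⟩
  · intro x y hxy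
    exact h1 (by omega)
  · simp [h2]
  · intro s hs
    simp only [min_eq_left hs]
    exact h3 s (by omega)
  · intro s hs
    simp only [min_eq_right hs, hr]

theorem isF_right {r k : ℕ} {f : ℕ → ℕ} (hf : IsG (r + k) r f) :
    IsF k (fun s => f (r + s) - (r + 1)) := by
  obtain ⟨⟨h1, h2, h3, h4⟩, hrn, hr, h5⟩ := hf
  refine ⟨?_, ?_, ?_, ?_⟩
  · intro x y hxy
    exact Nat.sub_le_sub_right (h1 (by omega)) _
  · simp [hr]
  · intro s hs
    dsimp only
    rcases Nat.eq_zero_or_pos s with h | h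
    · omega
    · have := h5 (r + s) (by omega) (by omega)
      omega
  · intro s hs
    dsimp only
    rcases Nat.lt_or_ge k s with h | h
    · rw [h4 _ (by omega)]; omega
    · have : s = k := by omega
      subst this
      rcases Nat.eq_zero_or_pos s with h | h
      · subst h; simp [hr]
      · have := h5 (r + s) (by omega) (by omega)
        have := h1 (show r + s ≤ r + s + 1 by omega)
        have := h4 (r + s + 1) le_rfl
        omega

theorem isG_glue {r k : ℕ} {f g : ℕ → ℕ} (hf : IsF r f) (hg : IsF k g) :
    IsG (r + k) r (fun s => if s ≤ r then f s else g (s - r) + (r + 1)) := by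
  obtain ⟨h1, h2, h3, h4⟩ := hf
  obtain ⟨g1, g2, g3, g4⟩ := hg
  refine ⟨⟨?_, ?_, ?_, ?_⟩, by omega, ?_, ?_⟩
  · intro x y hxy
    dsimp only
    split_ifs with ha hb hb
    · exact h1 hxy
    · have := h1 ha
      have := h4 r le_rfl
      omega
    · omega
    · have := g1 (show x - r ≤ y - r by omega)
      omega
  · simp [h2]
  · intro s hs
    dsimp only
    split_ifs with ha
    · exact h3 s ha
    · rcases Nat.lt_or_ge k (s - r) with h | h
      · have := g4 (s - r) (by omega)
        omega
      · have := g3 (s - r) h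
        omega
  · intro s hs
    dsimp only
    rw [if_neg (by omega), g4 _ (by omega)]
    omega
  · simp [h4 r le_rfl]
  · intro s ha hb
    dsimp only
    rw [if_neg (by omega)]
    have := g3 (s - r) (by omega)
    omega

theorem card_isG (r k : ℕ) :
    Nat.card {f : ℕ → ℕ // IsG (r + k) r f} =
      Nat.card {f : ℕ → ℕ // IsF r f} * Nat.card {f : ℕ → ℕ // IsF k f} := by
  rw [← Nat.card_prod]
  refine Nat.card_congr
    { toFun := fun f => (⟨_, isF_left f.2⟩, ⟨_, isF_right f.2⟩)
      invFun := fun p => ⟨_, isG_glue p.1.2 p.2.2⟩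
      left_inv := ?_
      right_inv := ?_ }
  · rintro ⟨f, hf⟩
    apply Subtype.ext
    funext s
    dsimp only
    split_ifs with h
    · rw [min_eq_left h]
    · have e : r + (s - r) = s := by omega
      rw [e]
      obtain ⟨⟨h1, h2, h3, h4⟩, hrn, hr, h5⟩ := hf
      have := h1 (show r + 1 ≤ s by omega)
      have := h3 (r + 1) (by omega)
      omega
  · rintro ⟨⟨f, hf⟩, ⟨g, hg⟩⟩
    refine Prod.ext (Subtype.ext ?_) (Subtype.ext ?_)
    · funext s
      dsimp only
      rw [if_pos (by omega)]
      rcases Nat.le_total s r with h | h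
      · rw [min_eq_left h]
      · rw [min_eq_right h, hf.2.2.2 r le_rfl, hf.2.2.2 s h]
    · funext s
      dsimp only
      split_ifs with h
      · have : s = 0 := by omega
        subst this
        have := hf.2.2.2 r le_rfl
        have := hg.2.1
        simp only [Nat.add_zero]
        omega
      · have e : r + s - r = s := by omega
        rw [e]; omega

theorem delta_le {N : ℕ} (a : Fin N → ℕ) (i : Fin N) : delta a i < N + 1 := by
  have := Finset.card_filter_le (Finset.univ : Finset (Fin N)) (fun j => j < i ∧ a j < a i)
  simp only [Finset.card_univ, Fintype.card_fin] at this
  unfold delta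
  omega

theorem finite_sd (m : ℕ) : Finite {a : Fin m → ℕ // delta a = a} := by
  refine Finite.of_injective (β := Fin m → Fin (m + 1))
    (fun a i => ⟨delta a.1 i, delta_le a.1 i⟩) ?_
  intro a b h
  apply Subtype.ext
  rw [← a.2, ← b.2]
  funext i
  exact congrArg Fin.val (congrFun h i)

theorem card_sd_succ (n : ℕ) :
    Nat.card {a : Fin (n + 1) → ℕ // delta a = a} =
      ∑ r : Fin (n + 1),
        Nat.card {a : Fin (n + 1) → ℕ // delta a = a ∧ a (Fin.last n) = r} := by
  have := finite_sd (n + 1)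
  have hfin : ∀ r : Fin (n + 1),
      Finite {a : Fin (n + 1) → ℕ // delta a = a ∧ a (Fin.last n) = r} := fun r =>
    Finite.of_injective (β := {a : Fin (n + 1) → ℕ // delta a = a})
      (fun a => ⟨a.1, a.2.1⟩) (fun a b h => Subtype.ext (Subtype.mk.inj h))
  rw [← Nat.card_sigma]
  refine (Nat.card_congr (Equiv.ofBijective (fun x => ⟨x.2.1, x.2.2.1⟩) ⟨?_, ?_⟩)).symm
  · rintro ⟨r, a, ha, har⟩ ⟨r', a', ha', har'⟩ h
    have h' : a = a' := congrArg Subtype.val h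
    subst h'
    have : r = r' := Fin.ext (har.symm.trans har')
    subst this
    rfl
  · rintro ⟨a, ha⟩
    exact ⟨⟨⟨a (Fin.last n), Nat.lt_succ_of_le (isG_cum a ha).2.1⟩, a, ha, rfl⟩, rfl⟩

theorem card_last_mul (n r : ℕ) (hr : r ≤ n) :
    Nat.card {a : Fin (n + 1) → ℕ // delta a = a ∧ a (Fin.last n) = r} =
      Nat.card {f : ℕ → ℕ // IsF r f} * Nat.card {f : ℕ → ℕ // IsF (n - r) f} := by
  obtain ⟨k, rfl⟩ := Nat.exists_eq_add_of_le hr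
  rw [card_sd_last, card_isG, Nat.add_sub_cancel_left]

theorem card_isF (m : ℕ) : Nat.card {f : ℕ → ℕ // IsF m f} = catalan m := by
  induction m using Nat.strong_induction_on with
  | _ m ih =>
    cases m with
    | zero => simp [isF_zero]
    | succ n =>
      rw [← card_sd, card_sd_succ, catalan_succ]
      refine Finset.sum_congr rfl fun r _ => ?_
      have := r.2
      rw [card_last_mul n r (by omega), ih _ r.2, ih _ (by omega)]

/-- For every `n` and every `r ≤ n`, the number of
self-describing sequences `(a_0, …, a_n)` with `a_n = r` is `c_r · c_{n−r}`. -/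
theorem stmt5 (n r : ℕ) (hr : r ≤ n) :
    Nat.card {a : Fin (n + 1) → ℕ // delta a = a ∧ a (Fin.last n) = r} =
      catalan r * catalan (n - r) := by
  rw [card_last_mul n r hr, card_isF, card_isF]
end

section
/- If a = (a_0, a_1, ..., a_n) is a self-describing sequence, then the extended sequence (a_0, a_1, ..., a_n, n+1) is also self-describing. -/
/-- If `a = (a_0, …, a_n)` is self-describing, then the extended
sequence `(a_0, …, a_n, n+1)` is also self-describing. -/
theorem stmt6 (n : ℕ) (a : Fin (n + 1) → ℕ) (ha : delta a = a) :
    delta (Fin.snoc a (n + 1)) = Fin.snoc a (n + 1) := by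
  have hlt : ∀ j, a j < n + 1 := by
    intro j
    rw [← ha]
    have h : (Finset.univ.filter (fun k => k < j ∧ a k < a j)) ⊂ Finset.univ := by
      rw [Finset.filter_ssubset]
      exact ⟨j, Finset.mem_univ _, by simp⟩
    simpa [delta] using Finset.card_lt_card h
  funext i
  refine Fin.lastCases ?_ (fun i => ?_) i
  · simp [-Finset.sum_boole, delta, Finset.card_filter, Fin.sum_univ_castSucc, fun j => Nat.le_of_lt_succ (hlt j), Fin.castSucc_lt_last]
  · conv_rhs => rw [Fin.snoc_castSucc, ← ha]
    have h : ¬ Fin.last (n + 1) < i.castSucc := not_lt.mpr (Fin.le_last _)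
    simp [-Finset.sum_boole, delta, Finset.card_filter, Fin.sum_univ_castSucc, h]
end

section
/- Let a = (a_0, a_1, ..., a_n) be a self-describing sequence with n ≥ 1 and let x be a natural number with x ≤ a_n. Then the extended sequence (a_0, a_1, ..., a_n, x) is self-describing if and only if the sequence (a_0, a_1, ..., a_{n−1}, x), obtained from a by replacing the last term by x, is self-describing. -/
theorem delta_snoc_s7 {m : ℕ} (b : Fin m → ℕ) (x : ℕ) :
    delta (Fin.snoc b x : Fin (m + 1) → ℕ) =
      (Fin.snoc (delta b) (Finset.univ.filter (fun j => b j < x)).card : Fin (m + 1) → ℕ) := by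
  funext i
  refine Fin.lastCases ?_ (fun i => ?_) i
  · simp only [delta, Fin.snoc_last, Finset.card_filter, Fin.sum_univ_castSucc, Fin.snoc_castSucc,
      Fin.castSucc_lt_last, true_and, lt_irrefl, false_and, if_false, add_zero]
  · have h : ¬ (Fin.last m < i.castSucc) := not_lt.mpr (Fin.le_last _)
    simp only [delta, Fin.snoc_last, Finset.card_filter, Fin.sum_univ_castSucc, Fin.snoc_castSucc,
      Fin.castSucc_lt_castSucc_iff, h, false_and, if_false, add_zero]

theorem delta_snoc_iff {m : ℕ} (b : Fin m → ℕ) (x : ℕ) :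
    delta (Fin.snoc b x : Fin (m + 1) → ℕ) = (Fin.snoc b x : Fin (m + 1) → ℕ) ↔
      delta b = b ∧ (Finset.univ.filter (fun j => b j < x)).card = x := by
  rw [delta_snoc_s7]
  constructor
  · intro h
    refine ⟨funext fun i => ?_, ?_⟩
    · simpa using congrFun h i.castSucc
    · simpa using congrFun h (Fin.last m)
  · rintro ⟨h1, h2⟩
    rw [h1, h2]

/-- Let `a = (a_0, …, a_n)` be self-describing with `n ≥ 1` and
let `x ≤ a_n`.  Then `(a_0, …, a_n, x)` is self-describing iff
`(a_0, …, a_{n−1}, x)` (replace the last term of `a` by `x`) is self-describing. -/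
theorem stmt7 (n : ℕ) (hn : 1 ≤ n) (a : Fin (n + 1) → ℕ) (ha : delta a = a)
    (x : ℕ) (hx : x ≤ a (Fin.last n)) :
    delta (Fin.snoc a x) = Fin.snoc a x ↔
      delta (Function.update a (Fin.last n) x) = Function.update a (Fin.last n) x := by
  have hu : Function.update a (Fin.last n) x =
      (Fin.snoc (fun i : Fin n => a i.castSucc) x : Fin (n + 1) → ℕ) := by
    funext i
    refine Fin.lastCases ?_ (fun i => ?_) i
    · simp
    · simp [Function.update_of_ne (Fin.castSucc_lt_last i).ne]
  have hs : a = (Fin.snoc (fun i : Fin n => a i.castSucc) (a (Fin.last n)) : Fin (n + 1) → ℕ) := by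
    funext i
    refine Fin.lastCases ?_ (fun i => ?_) i <;> simp
  have hb : delta (fun i : Fin n => a i.castSucc) = fun i : Fin n => a i.castSucc := by
    have h := ha
    rw [hs] at h
    exact ((delta_snoc_iff _ _).1 h).1
  rw [hu, delta_snoc_iff (fun i : Fin n => a i.castSucc) x]
  refine (delta_snoc_iff a x).trans ?_
  simp only [ha, hb, true_and, Finset.card_filter, Fin.sum_univ_castSucc, not_lt.mpr hx, if_false,
    add_zero]
end

section
/- Let a = (a_0, a_1, ..., a_n) be a self-describing sequence and let x be a natural number with a_n < x < n+1. Then the extended sequence (a_0, a_1, ..., a_n, x) is not self-describing. -/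
/-- Let `a = (a_0, …, a_n)` be self-describing and let `x` satisfy
`a_n < x < n+1`.  Then the extended sequence `(a_0, …, a_n, x)` is not
self-describing. -/
theorem stmt8 (n : ℕ) (a : Fin (n + 1) → ℕ) (ha : delta a = a)
    (x : ℕ) (hx1 : a (Fin.last n) < x) (hx2 : x < n + 1) :
    delta (Fin.snoc a x) ≠ Fin.snoc a x := by
  intro h
  have hle : ∀ i : Fin (n + 1), a i ≤ i := by
    intro i
    have h1 : delta a i = a i := congrFun ha i
    rw [← h1]
    calc delta a i ≤ (Finset.univ.filter (fun j => j < i)).card := by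
          unfold delta
          apply Finset.card_le_card
          intro j hj
          simp only [Finset.mem_filter, Finset.mem_univ, true_and] at hj ⊢
          exact hj.1
      _ = i := by
          have : Finset.univ.filter (fun j => j < i) = Finset.Iio i := by
            ext j; simp
          rw [this, Fin.card_Iio]
  have h2 := congrFun h (Fin.last (n + 1))
  rw [Fin.snoc_last] at h2
  unfold delta at h2
  rw [Fin.snoc_last] at h2
  have h3 : insert n (Finset.range x) ⊆ (Finset.univ.filter (fun j : Fin (n + 2) =>
      j < Fin.last (n + 1) ∧ (Fin.snoc a x : Fin (n + 2) → ℕ) j < x)).image Fin.val := by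
    intro k hk
    rw [Finset.mem_insert, Finset.mem_range] at hk
    have hkn : k < n + 1 := by omega
    rw [Finset.mem_image]
    refine ⟨Fin.castSucc ⟨k, hkn⟩, ?_, rfl⟩
    rw [Finset.mem_filter]
    refine ⟨Finset.mem_univ _, Fin.castSucc_lt_last _, ?_⟩
    rw [Fin.snoc_castSucc (α := fun _ => ℕ)]
    rcases hk with hk | hk
    · subst hk
      exact hx1
    · exact lt_of_le_of_lt (hle _) hk
  have h4 := (Finset.card_le_card h3).trans Finset.card_image_le
  rw [Finset.card_insert_of_notMem (by rw [Finset.mem_range]; omega), Finset.card_range] at h4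
  exact absurd (h4.trans h2.le) (by omega)
end

section
/- For every n ≥ 1 and every r with 0 ≤ r ≤ n, the number of sequences with unit increase (a_0, a_1, ..., a_n) whose last term satisfies a_n = r is equal to ((r+1)/(n+1))·binomial(2n−r, n). Equivalently, (n+1) times this number of sequences equals (r+1)·binomial(2n−r, n). -/
/-- A sequence with unit increase: `a_0 = 0` and `a_{i+1} ≤ a_i + 1` for all `i`. -/
def UnitIncrease {n : ℕ} (a : Fin (n + 1) → ℕ) : Prop :=
  a 0 = 0 ∧ ∀ i : Fin n, a i.succ ≤ a i.castSucc + 1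

theorem UnitIncrease.le {n : ℕ} {a : Fin (n + 1) → ℕ} (h : UnitIncrease a) (i : Fin (n + 1)) :
    a i ≤ i := by
  induction i using Fin.induction with
  | zero => simp [h.1]
  | succ i ih =>
    have := h.2 i
    simp at ih ⊢
    omega

abbrev SeqSet (n r : ℕ) : Type := {a : Fin (n + 1) → ℕ // UnitIncrease a ∧ a (Fin.last n) = r}

instance finite_SeqSet (n r : ℕ) : Finite (SeqSet n r) := by
  have : Finite {a : Fin (n + 1) → ℕ // a ∈ Set.Iic (fun _ : Fin (n + 1) => n)} :=
    (Set.finite_Iic _).to_subtype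
  refine Finite.of_injective (β := {a : Fin (n + 1) → ℕ // a ∈ Set.Iic (fun _ : Fin (n + 1) => n)})
    (fun a => ⟨a.1, ?_⟩) ?_
  · intro i
    have := a.2.1.le i
    have := i.2
    show a.1 i ≤ n
    omega
  · intro a b h
    exact Subtype.ext (Subtype.mk.inj h)

theorem unitIncrease_snoc {n : ℕ} (b : Fin (n + 1) → ℕ) (r : ℕ) :
    UnitIncrease (Fin.snoc (α := fun _ => ℕ) b r : Fin (n + 2) → ℕ) ↔
      UnitIncrease b ∧ r ≤ b (Fin.last n) + 1 := by
  unfold UnitIncrease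
  rw [Fin.forall_fin_succ', and_assoc]
  refine and_congr ?_ (and_congr (forall_congr' fun i => ?_) ?_)
  · rw [← Fin.castSucc_zero, Fin.snoc_castSucc]
  · rw [Fin.succ_castSucc, Fin.snoc_castSucc, Fin.snoc_castSucc]
  · rw [Fin.succ_last, Fin.snoc_last, Fin.snoc_castSucc]

theorem snoc_init_eq {n : ℕ} (a : Fin (n + 2) → ℕ) (r : ℕ) (h : a (Fin.last (n + 1)) = r) :
    (Fin.snoc (α := fun _ => ℕ) (Fin.init (α := fun _ => ℕ) a) r : Fin (n + 2) → ℕ) = a := by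
  subst h
  exact Fin.snoc_init_self _

theorem sigma_ext_aux {n : ℕ} {P : Finset ℕ} (x y : Σ s : P, SeqSet n s) (h : x.2.1 = y.2.1) :
    x = y := by
  obtain ⟨⟨s, hs⟩, ⟨b, hb, e⟩⟩ := x
  obtain ⟨⟨t, ht⟩, ⟨c, hc, e2⟩⟩ := y
  change b = c at h
  subst h
  have : s = t := e.symm.trans e2
  subst this
  rfl

def seqEquiv (n r : ℕ) :
    SeqSet (n + 1) r ≃ Σ s : Finset.Ico (r - 1) (n + 1), SeqSet n s where
  toFun a :=
    have h : UnitIncrease (Fin.init (α := fun _ => ℕ) a.1) ∧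
        r ≤ Fin.init (α := fun _ => ℕ) a.1 (Fin.last n) + 1 := by
      rw [← unitIncrease_snoc]
      rw [snoc_init_eq a.1 r a.2.2]
      exact a.2.1
    ⟨⟨Fin.init (α := fun _ => ℕ) a.1 (Fin.last n), by
      have := h.1.le (Fin.last n)
      have := h.2
      simp at *
      omega⟩, ⟨Fin.init (α := fun _ => ℕ) a.1, h.1, rfl⟩⟩
  invFun b := ⟨Fin.snoc (α := fun _ => ℕ) b.2.1 r, by
    have h1 := b.1.2
    have h2 := b.2.2
    rw [unitIncrease_snoc]
    simp only [Finset.mem_Ico] at h1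
    refine ⟨⟨h2.1, ?_⟩, by simp⟩
    rw [h2.2]
    omega⟩
  left_inv a := by
    apply Subtype.ext
    exact snoc_init_eq a.1 r a.2.2
  right_inv b := by
    apply sigma_ext_aux
    exact Fin.init_snoc (α := fun _ => ℕ) _ _

theorem card_succ (n r : ℕ) : Nat.card (SeqSet (n + 1) r) =
    ∑ s ∈ Finset.Ico (r - 1) (n + 1), Nat.card (SeqSet n s) := by
  rw [Nat.card_congr (seqEquiv n r), Nat.card_sigma,
    Finset.sum_coe_sort (Finset.Ico (r - 1) (n + 1)) (fun s => Nat.card (SeqSet n s))]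

theorem card_zero : Nat.card (SeqSet 0 0) = 1 := by
  rw [Nat.card_eq_one_iff_unique]
  refine ⟨⟨fun a b => Subtype.ext (funext fun i => ?_)⟩,
    ⟨⟨fun _ => 0, ⟨rfl, fun i => i.elim0⟩, rfl⟩⟩⟩
  have h1 := a.2.1.1
  have h2 := b.2.1.1
  rw [show i = 0 by omega, h1, h2]

theorem card_step (n r : ℕ) (h : r ≤ n) : Nat.card (SeqSet (n + 1) (r + 1)) =
    Nat.card (SeqSet n r) + Nat.card (SeqSet (n + 1) (r + 2)) := by
  rw [card_succ, card_succ]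
  exact Finset.sum_eq_sum_Ico_succ_bot (by omega) _

theorem card_closed (n : ℕ) : ∀ k r, k + r = n →
    Nat.card (SeqSet n r) + Nat.choose (n + k) (n + 1) = Nat.choose (n + k) n := by
  induction n with
  | zero =>
    intro k r h
    obtain ⟨rfl, rfl⟩ : k = 0 ∧ r = 0 := by omega
    simp [card_zero]
  | succ n ih =>
    have key : ∀ k r, k + r = n → Nat.card (SeqSet (n + 1) (r + 1)) +
        Nat.choose (n + 1 + k) (n + 2) = Nat.choose (n + 1 + k) (n + 1) := by
      intro k
      induction k with
      | zero =>
        intro r h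
        obtain rfl : r = n := by omega
        have h0 := ih 0 r (by omega)
        rw [card_step r r le_rfl, card_succ r (r + 2)]
        simp at h0 ⊢
        exact h0
      | succ k ihk =>
        intro r h
        have h1 := ihk (r + 1) (by omega)
        have h2 := ih (k + 1) r (by omega)
        rw [card_step n r (by omega)]
        have e1 := Nat.choose_succ_succ (n + 1 + k) (n + 1)
        have e2 := Nat.choose_succ_succ (n + 1 + k) n
        rw [show n + (k + 1) = n + 1 + k by ring] at h2
        rw [show n + 1 + (k + 1) = (n + 1 + k).succ by omega]
        simp only [Nat.succ_eq_add_one, add_assoc, Nat.reduceAdd] at *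
        omega
    intro k r h
    cases r with
    | succ r => exact key k r (by omega)
    | zero =>
      obtain rfl : k = n + 1 := by omega
      have h1 := key n 0 (by omega)
      have e0 : Nat.card (SeqSet (n + 1) 0) = Nat.card (SeqSet (n + 1) (0 + 1)) := by
        rw [card_succ, card_succ]
      have e1 := Nat.choose_succ_succ (n + 1 + n) (n + 1)
      have e2 := Nat.choose_succ_succ (n + 1 + n) n
      have e3 : (n + 1 + n).choose (n + 1) = (n + 1 + n).choose n :=
        Nat.choose_symm_add
      rw [e0, show n + 1 + (n + 1) = (n + 1 + n).succ by omega]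
      simp only [Nat.succ_eq_add_one, add_assoc, Nat.reduceAdd] at *
      omega

/-- For every `n ≥ 1` and `0 ≤ r ≤ n`, the number of sequences
with unit increase `(a_0, …, a_n)` with `a_n = r` equals
`((r+1)/(n+1))·C(2n−r, n)`; equivalently, `(n+1)` times this number equals
`(r+1)·C(2n−r, n)`. -/
theorem stmt10 (n r : ℕ) (hn : 1 ≤ n) (hr : r ≤ n) :
    (n + 1) * Nat.card {a : Fin (n + 1) → ℕ // UnitIncrease a ∧ a (Fin.last n) = r} =
      (r + 1) * Nat.choose (2 * n - r) n := by
  obtain ⟨k, rfl⟩ := Nat.exists_eq_add_of_le' hr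
  have h := card_closed (k + r) k r rfl
  have h2 := Nat.choose_succ_right_eq (k + r + k) (k + r)
  rw [show 2 * (k + r) - r = k + r + k by omega]
  rw [show k + r + k - (k + r) = k by omega] at h2
  change (k + r + 1) * Nat.card (SeqSet (k + r) r) = _
  rw [← h] at h2 ⊢
  nlinarith [h2]
end

section
/- Fix a positive integer m. For every n ≥ 1 and every r with 0 ≤ r ≤ mn, the set of sequences with m-increase (a_0, a_1, ..., a_n) ending with a_n = r is in bijection with the set of sequences consisting of n terms equal to m and mn−r terms equal to −1 all of whose partial sums are non-negative; in particular the two sets have the same cardinality. -/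
/-- A sequence with `m`-increase: `a_0 = 0` and `a_{i+1} ≤ a_i + m` for all `i`. -/
def MIncrease (m : ℕ) {n : ℕ} (a : Fin (n + 1) → ℕ) : Prop :=
  a 0 = 0 ∧ ∀ i : Fin n, a i.succ ≤ a i.castSucc + m

def BSet (m N n : ℕ) : Set (Fin N → ℤ) :=
  {b | (∀ i, b i = (m : ℤ) ∨ b i = -1) ∧
          (Finset.univ.filter (fun i => b i = (m : ℤ))).card = n ∧
          ∀ k : Fin N, 0 ≤ ∑ j ∈ Finset.univ.filter (fun j => j ≤ k), b j}

def ASet (m n r : ℕ) : Set (Fin (n + 1) → ℕ) :=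
  {a | MIncrease m a ∧ a (Fin.last n) = r}

def CSet (m n r : ℕ) : Set (Fin (n + 1) → ℕ) :=
  {a | MIncrease m a ∧ r ≤ a (Fin.last n) + m}

theorem mincrease_snoc (m n : ℕ) (a : Fin (n + 1) → ℕ) (x : ℕ) :
    MIncrease m (Fin.snoc a x : Fin (n + 2) → ℕ) ↔
      MIncrease m a ∧ x ≤ a (Fin.last n) + m := by
  unfold MIncrease
  rw [Fin.forall_fin_succ']
  have h0 : (Fin.snoc a x : Fin (n + 2) → ℕ) 0 = a 0 := by
    rw [← Fin.castSucc_zero, Fin.snoc_castSucc (α := fun _ => ℕ)]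
  rw [h0]
  simp only [Fin.succ_castSucc, Fin.snoc_castSucc (α := fun _ => ℕ), Fin.succ_last,
    Fin.snoc_last]
  tauto

theorem mincrease_le (m n : ℕ) (a : Fin (n + 1) → ℕ) (h : MIncrease m a) (i : Fin (n + 1)) :
    a i ≤ m * i := by
  induction i using Fin.induction with
  | zero => simp [h.1]
  | succ i ih =>
    have := h.2 i
    simp only [Fin.val_castSucc, Fin.val_succ] at *
    rw [Nat.mul_succ]
    omega

theorem mincrease_finite (m n : ℕ) : {a : Fin (n + 1) → ℕ | MIncrease m a}.Finite := by
  refine (Set.Finite.pi' (fun i : Fin (n + 1) => Set.finite_Iic (m * (i : ℕ)))).subset ?_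
  intro a ha i
  exact mincrease_le m n a ha i

theorem ASet_finite (m n r : ℕ) : (ASet m n r).Finite :=
  (mincrease_finite m n).subset fun _ h => h.1

theorem CSet_finite (m n r : ℕ) : (CSet m n r).Finite :=
  (mincrease_finite m n).subset fun _ h => h.1

theorem ASet_succ (m n r : ℕ) : (ASet m (n + 1) r).ncard = (CSet m n r).ncard := by
  have hinj : Function.Injective (fun a : Fin (n + 1) → ℕ => (Fin.snoc a r : Fin (n + 2) → ℕ)) :=
    fun a b h => Fin.snoc_left_injective (α := fun _ => ℕ) r h
  rw [← Set.ncard_image_of_injective _ hinj]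
  congr 1
  ext a
  simp only [Set.mem_image]
  constructor
  · rintro ⟨h1, h2⟩
    have e : (Fin.snoc (Fin.init a) r : Fin (n + 2) → ℕ) = a := by
      rw [← h2]; exact Fin.snoc_init_self a
    refine ⟨Fin.init a, ?_, e⟩
    rw [← e, mincrease_snoc] at h1
    exact h1
  · rintro ⟨b, hb, rfl⟩
    exact ⟨(mincrease_snoc m n b r).2 hb, by simp⟩

theorem CSet_split (m n r s : ℕ) (h : r = s + m) :
    (CSet m n r).ncard = (CSet m n (r + 1)).ncard + (ASet m n s).ncard := by
  rw [← Set.ncard_union_eq _ (CSet_finite _ _ _) (ASet_finite _ _ _)]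
  · congr 1
    ext a
    simp only [CSet, ASet, Set.mem_union, Set.mem_setOf_eq]
    have : r ≤ a (Fin.last n) + m ↔ (r + 1 ≤ a (Fin.last n) + m ∨ a (Fin.last n) = s) := by omega
    rw [this]; tauto
  · rw [Set.disjoint_left]
    rintro a ⟨_, h1⟩ ⟨_, h2⟩
    omega

theorem CSet_lt (m n r : ℕ) (h : r < m) : CSet m n r = CSet m n (r + 1) := by
  ext a
  simp only [CSet, Set.mem_setOf_eq]
  have : r ≤ a (Fin.last n) + m ↔ r + 1 ≤ a (Fin.last n) + m := by omega
  rw [this]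

theorem CSet_empty (m n r : ℕ) (h : m * (n + 1) < r) : CSet m n r = ∅ := by
  ext a
  simp only [CSet, Set.mem_setOf_eq, Set.mem_empty_iff_false, iff_false]
  rintro ⟨h1, h2⟩
  have := mincrease_le m n a h1 (Fin.last n)
  simp only [Fin.val_last, Nat.mul_succ] at *
  omega

theorem BSet_finite (m N n : ℕ) : (BSet m N n).Finite := by
  refine (Set.Finite.pi' (fun _ : Fin N => Set.toFinite {(m : ℤ), -1})).subset ?_
  intro b hb i
  exact hb.1 i

theorem sum_eq (m N : ℕ) (b : Fin N → ℤ) (h : ∀ i, b i = (m : ℤ) ∨ b i = -1) :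
    ∑ i, b i = (m + 1) * ((Finset.univ.filter (fun i => b i = (m : ℤ))).card : ℤ) - N := by
  have h1 : ∀ i, b i = (m + 1) * (if b i = (m : ℤ) then 1 else 0) - 1 := by
    intro i
    split_ifs with hi
    · rw [hi]; ring
    · rcases h i with h | h
      · exact absurd h hi
      · rw [h]; ring
  rw [Finset.sum_congr rfl (fun i _ => h1 i), Finset.sum_sub_distrib, ← Finset.mul_sum]
  simp

theorem BSet_snoc (m N n : ℕ) (b : Fin N → ℤ) (x : ℤ) :
    (Fin.snoc b x : Fin (N + 1) → ℤ) ∈ BSet m (N + 1) n ↔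
      ((∀ i, b i = (m : ℤ) ∨ b i = -1) ∧ (x = m ∨ x = -1)) ∧
      (Finset.univ.filter (fun i => b i = (m : ℤ))).card + (if x = m then 1 else 0) = n ∧
      (∀ k : Fin N, 0 ≤ ∑ j ∈ Finset.univ.filter (fun j => j ≤ k), b j) ∧
      0 ≤ ∑ i, b i + x := by
  unfold BSet
  simp only [Set.mem_setOf_eq]
  rw [Fin.forall_fin_succ', Fin.forall_fin_succ']
  simp only [Finset.card_filter, Finset.sum_filter, Fin.sum_univ_castSucc,
    Fin.snoc_castSucc (α := fun _ => ℤ), Fin.snoc_last, Fin.castSucc_le_castSucc_iff,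
    Fin.le_last, if_true]
  have : ∀ k : Fin N, ¬ Fin.last N ≤ k.castSucc := fun k => not_le.2 (Fin.castSucc_lt_last k)
  simp [this]

theorem BSet_total (m N n : ℕ) (b : Fin N → ℤ) (h : b ∈ BSet m N n) : N ≤ (m + 1) * n := by
  cases N with
  | zero => simp
  | succ N =>
    have h1 := h.2.2 (Fin.last N)
    have h2 := sum_eq m _ b h.1
    rw [h.2.1] at h2
    simp only [Fin.le_last, Finset.filter_true] at h1
    rw [h2] at h1
    zify
    push_cast at h1
    linarith

theorem BSet_empty (m N n : ℕ) (h : (m + 1) * n < N) : BSet m N n = ∅ :=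
  Set.eq_empty_of_forall_notMem fun b hb => absurd (BSet_total m N n b hb) (by omega)

theorem BSet_empty' (m N n : ℕ) (h : N < n) : BSet m N n = ∅ :=
  Set.eq_empty_of_forall_notMem fun b hb => by
    have := hb.2.1
    have h2 := Finset.card_filter_le (Finset.univ : Finset (Fin N)) (fun i => b i = (m : ℤ))
    simp at h2
    omega

theorem BSet_succ (m N n : ℕ) (h : N + 1 ≤ (m + 1) * (n + 1)) :
    (BSet m (N + 1) (n + 1)).ncard = (BSet m N (n + 1)).ncard + (BSet m N n).ncard := by
  have hinj : ∀ x : ℤ,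
      Function.Injective (fun a : Fin N → ℤ => (Fin.snoc a x : Fin (N + 1) → ℤ)) :=
    fun x a b h => Fin.snoc_left_injective (α := fun _ => ℤ) x h
  have hm : (-1 : ℤ) ≠ m := by omega
  zify at h
  rw [← Set.ncard_image_of_injective _ (hinj (-1)), ← Set.ncard_image_of_injective _ (hinj m),
    ← Set.ncard_union_eq _ ((BSet_finite _ _ _).image _) ((BSet_finite _ _ _).image _)]
  · congr 1
    ext a
    simp only [Set.mem_union, Set.mem_image]
    constructor
    · intro ha
      have e : (Fin.snoc (Fin.init a) (a (Fin.last N)) : Fin (N + 1) → ℤ) = a :=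
        Fin.snoc_init_self a
      generalize Fin.init a = b at e
      generalize a (Fin.last N) = x at e
      subst e
      rw [BSet_snoc] at ha
      obtain ⟨⟨h1, h2⟩, h3, h4, h5⟩ := ha
      rcases h2 with rfl | rfl
      · right
        exact ⟨b, ⟨h1, by simpa using h3, h4⟩, rfl⟩
      · left
        exact ⟨b, ⟨h1, by simpa [hm] using h3, h4⟩, rfl⟩
    · rintro (⟨b, ⟨h1, h2, h3⟩, rfl⟩ | ⟨b, ⟨h1, h2, h3⟩, rfl⟩)
      · refine (BSet_snoc _ _ _ _ _).2 ⟨⟨h1, Or.inr rfl⟩, by simpa [hm] using h2, h3, ?_⟩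
        rw [sum_eq m N b h1, h2]
        push_cast
        linarith
      · refine (BSet_snoc _ _ _ _ _).2 ⟨⟨h1, Or.inl rfl⟩, by simpa using h2, h3, ?_⟩
        rw [sum_eq m N b h1, h2]
        linarith
  · rw [Set.disjoint_left]
    rintro a ⟨b, _, rfl⟩ ⟨c, _, h2⟩
    have := congrFun h2 (Fin.last N)
    simp only [Fin.snoc_last] at this
    exact hm this.symm

theorem main_card (m n : ℕ) : ∀ k r, r + k = m * n →
    (ASet m n r).ncard = (BSet m (n + k) n).ncard := by
  induction n with
  | zero =>
    intro k r h
    obtain ⟨rfl, rfl⟩ : r = 0 ∧ k = 0 := by omega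
    have h1 : ASet m 0 0 = {fun _ => 0} := by
      ext a
      simp only [ASet, MIncrease, Set.mem_setOf_eq, Set.mem_singleton_iff]
      constructor
      · rintro ⟨⟨h, _⟩, _⟩
        funext i
        rw [show i = 0 from Fin.ext (by have := i.isLt; simp only [Fin.val_zero]; omega), h]
      · rintro rfl
        simp
    have h2 : BSet m (0 + 0) 0 = {fun _ => 0} := by
      ext a
      simp only [Set.mem_singleton_iff]
      refine ⟨fun _ => funext fun i => i.elim0, fun _ => ⟨fun i => i.elim0, ?_, fun i => i.elim0⟩⟩
      simp
    rw [h1, h2, Set.ncard_singleton, Set.ncard_singleton]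
  | succ n ih =>
    have key : ∀ k r, r + k = m * (n + 1) → (CSet m n r).ncard =
        (CSet m n (r + 1)).ncard + (BSet m (n + k) n).ncard := by
      intro k r h
      rw [Nat.mul_succ] at h
      rcases lt_or_ge r m with hr | hr
      · rw [CSet_lt m n r hr, BSet_empty m (n + k) n (by rw [Nat.succ_mul]; omega)]
        simp
      · rw [CSet_split m n r (r - m) (by omega), ih k (r - m) (by omega)]
    intro k
    induction k with
    | zero =>
      intro r h
      rw [ASet_succ, key 0 r h, CSet_empty m n (r + 1) (by omega)]
      rw [show n + 1 + 0 = n + 0 + 1 by omega, BSet_succ m (n + 0) n (by rw [Nat.succ_mul]; omega),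
        BSet_empty' m (n + 0) (n + 1) (by omega)]
      simp
    | succ k ihk =>
      intro r h
      rw [ASet_succ, key (k + 1) r h, ← ASet_succ, ihk (r + 1) (by omega)]
      rw [show n + 1 + (k + 1) = n + (k + 1) + 1 by omega,
        BSet_succ m (n + (k + 1)) n (by rw [Nat.succ_mul]; omega),
        show n + 1 + k = n + (k + 1) by omega]

/-- Fix `m ≥ 1`.  For every `n ≥ 1` and `0 ≤ r ≤ mn`, the set of
sequences with `m`-increase `(a_0, …, a_n)` ending with `a_n = r` is in bijection
with the set of sequences consisting of `n` terms equal to `m` and `mn − r` terms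
equal to `−1`, all of whose partial sums are non-negative; in particular the two
sets have the same cardinality. -/
theorem stmt13 (m : ℕ) (hm : 1 ≤ m) (n r : ℕ) (hn : 1 ≤ n) (hr : r ≤ m * n) :
    Nonempty
      ({a : Fin (n + 1) → ℕ // MIncrease m a ∧ a (Fin.last n) = r} ≃
       {b : Fin (n + (m * n - r)) → ℤ //
          (∀ i, b i = (m : ℤ) ∨ b i = -1) ∧
          (Finset.univ.filter (fun i => b i = (m : ℤ))).card = n ∧
          ∀ k : Fin (n + (m * n - r)),
            0 ≤ ∑ j ∈ Finset.univ.filter (fun j => j ≤ k), b j}) ∧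
    Nat.card {a : Fin (n + 1) → ℕ // MIncrease m a ∧ a (Fin.last n) = r} =
      Nat.card {b : Fin (n + (m * n - r)) → ℤ //
          (∀ i, b i = (m : ℤ) ∨ b i = -1) ∧
          (Finset.univ.filter (fun i => b i = (m : ℤ))).card = n ∧
          ∀ k : Fin (n + (m * n - r)),
            0 ≤ ∑ j ∈ Finset.univ.filter (fun j => j ≤ k), b j} := by
  have hc : Nat.card (ASet m n r) = Nat.card (BSet m (n + (m * n - r)) n) :=
    main_card m n (m * n - r) r (by omega)
  have : Finite (ASet m n r) := ASet_finite m n r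
  have : Finite (BSet m (n + (m * n - r)) n) := BSet_finite m _ n
  have he := Finite.card_eq.1 hc
  exact ⟨he, hc⟩
end

section
/- Fix a positive integer m. The number of sequences with m-increase of length n+1, i.e., sequences (a_0, a_1, ..., a_n) of natural numbers with a_0 = 0 and a_{i+1} ≤ a_i + m for all i, is equal to c_m(n+1) = (1/(m(n+1)+1))·binomial((m+1)(n+1), n+1). Equivalently, (m(n+1)+1) times this number of sequences equals binomial((m+1)(n+1), n+1). -/
/-- Sequences with `m`-increase starting at `k`. -/
def SeqFrom (m n k : ℕ) : Type :=
  {a : Fin (n + 1) → ℕ // a 0 = k ∧ ∀ i : Fin n, a i.succ ≤ a i.castSucc + m}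

/-- Splitting off the first term. -/
def seqFromEquiv (m n k : ℕ) :
    SeqFrom m (n + 1) k ≃ Σ j : Fin (k + m + 1), SeqFrom m n j where
  toFun a := ⟨⟨a.1 1, by
      have h := a.2.2 0
      have h0 := a.2.1
      simp only [Fin.succ_zero_eq_one, Fin.castSucc_zero] at h
      omega⟩, ⟨fun i => a.1 i.succ, by simp, fun i => by
        have h := a.2.2 i.succ
        simpa using h⟩⟩
  invFun b := ⟨Fin.cons k b.2.1, by simp, fun i => by
    refine Fin.cases ?_ (fun i => ?_) i
    · have h := b.2.2.1
      have h1 := b.1.2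
      simp only [Fin.cons_succ, Fin.castSucc_zero, Fin.cons_zero]
      omega
    · have h := b.2.2.2 i
      simpa [← Fin.succ_castSucc] using h⟩
  left_inv a := by
    apply Subtype.ext
    funext i
    refine Fin.cases ?_ (fun i => ?_) i
    · simpa using a.2.1.symm
    · simp
  right_inv b := by
    obtain ⟨⟨j, hj⟩, ⟨b, hb, hb'⟩⟩ := b
    dsimp only at hb
    subst hb
    rfl

theorem seqFrom_finite (m n : ℕ) : ∀ k, Finite (SeqFrom m n k) := by
  induction n with
  | zero =>
    intro k
    have : Subsingleton (SeqFrom m 0 k) := ⟨fun a b => by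
      apply Subtype.ext
      funext i
      rw [show i = 0 from Fin.ext (by have := i.2; simp), a.2.1, b.2.1]⟩
    infer_instance
  | succ n ih =>
    intro k
    have := fun j : Fin (k + m + 1) => ih j
    exact Finite.of_equiv _ (seqFromEquiv m n k).symm

theorem seqFrom_card_zero (m k : ℕ) : Nat.card (SeqFrom m 0 k) = 1 := by
  rw [Nat.card_eq_one_iff_unique]
  refine ⟨⟨fun a b => ?_⟩, ⟨⟨fun _ => k, rfl, fun i => i.elim0⟩⟩⟩
  apply Subtype.ext
  funext i
  rw [show i = 0 from Fin.ext (by have := i.2; simp), a.2.1, b.2.1]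

theorem seqFrom_card_succ (m n k : ℕ) :
    Nat.card (SeqFrom m (n + 1) k) =
      ∑ j ∈ Finset.range (k + m + 1), Nat.card (SeqFrom m n j) := by
  have := seqFrom_finite m n
  rw [Nat.card_congr (seqFromEquiv m n k), Nat.card_sigma,
    Finset.sum_range (fun j => Nat.card (SeqFrom m n j))]

/-- Raney numbers `A_{n+1}(m+1, r)`. -/
def raney (m n r : ℕ) : ℤ :=
  ((m + 1) * n + m + r).choose (n + 1) - m * ((m + 1) * n + m + r).choose n

theorem raney_zero (m n : ℕ) : raney m n 0 = 0 := by
  unfold raney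
  have h := Nat.choose_succ_right_eq ((m + 1) * n + m + 0) n
  have e : (m + 1) * n + m + 0 - n = m * (n + 1) := by
    have : (m + 1) * n + m + 0 = m * (n + 1) + n := by ring
    omega
  rw [e] at h
  have h2 : ((m + 1) * n + m + 0).choose (n + 1) = m * ((m + 1) * n + m + 0).choose n := by
    apply Nat.eq_of_mul_eq_mul_right (Nat.succ_pos n)
    rw [Nat.succ_eq_add_one, h]; ring
  rw [h2]; push_cast; ring

theorem raney_step (m n r : ℕ) :
    raney m (n + 1) (r + 1) - raney m (n + 1) r = raney m n (r + m + 1) := by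
  unfold raney
  have e : (m + 1) * n + m + (r + m + 1) = (m + 1) * (n + 1) + m + r := by ring
  rw [e, ← Nat.add_assoc, Nat.choose_succ_succ, Nat.choose_succ_succ _ n]
  push_cast; ring

theorem raney_step0 (m r : ℕ) : raney m 0 r = r := by
  simp [raney]

theorem seqFrom_sum (m n : ℕ) :
    ∀ K, (∑ j ∈ Finset.range K, (Nat.card (SeqFrom m n j) : ℤ)) = raney m n K := by
  induction n with
  | zero => intro K; simp [seqFrom_card_zero, raney_step0]
  | succ n ih =>
    intro K
    induction K with
    | zero => simp [raney_zero]
    | succ K ihK =>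
      rw [Finset.sum_range_succ, ihK, seqFrom_card_succ]
      push_cast
      rw [ih, Nat.add_assoc, ← Nat.add_assoc, ← raney_step]; ring

/-- Fix `m ≥ 1`.  The number of sequences with `m`-increase of
length `n+1` equals the generalized Catalan number
`c_m(n+1) = (1/(m(n+1)+1))·C((m+1)(n+1), n+1)`; equivalently, `(m(n+1)+1)` times
this number equals `C((m+1)(n+1), n+1)`. -/
theorem stmt14 (m : ℕ) (hm : 1 ≤ m) (n : ℕ) :
    (m * (n + 1) + 1) * Nat.card {a : Fin (n + 1) → ℕ // MIncrease m a} =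
      Nat.choose ((m + 1) * (n + 1)) (n + 1) := by
  have key : Nat.card {a : Fin (n + 1) → ℕ // MIncrease m a} = Nat.card (SeqFrom m n 0) := rfl
  rw [key]
  cases n with
  | zero => simp [seqFrom_card_zero]
  | succ n =>
    have hc : (Nat.card (SeqFrom m (n + 1) 0) : ℤ) = raney m n (m + 1) := by
      rw [seqFrom_card_succ]
      push_cast
      rw [seqFrom_sum, Nat.zero_add]
    unfold raney at hc
    set N := (m + 1) * n + m + (m + 1) with hN
    have e : (m + 1) * (n + 1 + 1) = N + 1 := by rw [hN]; ring
    have h1 := Nat.add_one_mul_choose_eq N (n + 1)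
    have h2 : (N + 1).choose (n + 1 + 1) = (m + 1) * N.choose (n + 1) := by
      apply Nat.eq_of_mul_eq_mul_right (Nat.succ_pos (n + 1))
      rw [Nat.succ_eq_add_one, ← h1, ← e]; ring
    have h3 := Nat.choose_succ_right_eq N n
    have e2 : N - n = m * (n + 1 + 1) + 1 := by
      have : N = m * (n + 1 + 1) + 1 + n := by rw [hN]; ring
      omega
    rw [e2] at h3
    rw [e, h2]
    zify at h3 ⊢
    rw [hc]
    linear_combination (m : ℤ) * h3
end

section
/- For every admissible sequence a = (a_0, a_1, ..., a_n), repeated application of γ eventually produces a double point: there exists m ≥ 0 such that γ^{m+2} a = γ^m a. -/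
/-- The transformation `γ`: `(γa)_i = #{ j | j < i ∧ a_j ≥ a_i }`. -/
def gamma {N : ℕ} (a : Fin N → ℕ) : Fin N → ℕ :=
  fun i => (Finset.univ.filter (fun j => j < i ∧ a i ≤ a j)).card

theorem gamma_agree {N k : ℕ} {b c : Fin N → ℕ} (h : ∀ i : Fin N, i.val < k → b i = c i) :
    ∀ i : Fin N, i.val < k → gamma b i = gamma c i := by
  intro i hi
  unfold gamma
  congr 1
  apply Finset.filter_congr
  intro j _
  constructor
  · rintro ⟨h1, h2⟩
    have hj : j.val < k := lt_trans h1 hi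
    exact ⟨h1, by rw [← h i hi, ← h j hj]; exact h2⟩
  · rintro ⟨h1, h2⟩
    have hj : j.val < k := lt_trans h1 hi
    exact ⟨h1, by rw [h i hi, h j hj]; exact h2⟩

theorem gamma_anti {N : ℕ} {b c : Fin N → ℕ} (k : Fin N)
    (h : ∀ i : Fin N, i.val < k.val → b i = c i) (hk : b k ≤ c k) :
    gamma c k ≤ gamma b k := by
  unfold gamma
  apply Finset.card_le_card
  intro j hj
  simp only [Finset.mem_filter, Finset.mem_univ, true_and] at hj ⊢
  refine ⟨hj.1, ?_⟩
  rw [h j hj.1]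
  exact hk.trans hj.2

theorem gamma_le {N : ℕ} (b : Fin N → ℕ) (k : Fin N) : gamma b k ≤ N := by
  unfold gamma
  exact (Finset.card_le_univ _).trans (by simp)

theorem iter_agree {N k : ℕ} {b c : Fin N → ℕ} (h : ∀ i : Fin N, i.val < k → b i = c i) (t : ℕ) :
    ∀ i : Fin N, i.val < k → gamma^[t] b i = gamma^[t] c i := by
  induction t with
  | zero => exact h
  | succ t ih =>
    rw [Function.iterate_succ_apply', Function.iterate_succ_apply']
    exact gamma_agree ih

theorem iter_mono {N : ℕ} {b c : Fin N → ℕ} (k : Fin N)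
    (h : ∀ i : Fin N, i.val < k.val → b i = c i) (hk : b k ≤ c k) (t : ℕ) :
    gamma^[2 * t] b k ≤ gamma^[2 * t] c k := by
  induction t with
  | zero => exact hk
  | succ t ih =>
    have e : 2 * (t + 1) = (2 * t + 1) + 1 := by ring
    rw [e]
    simp only [Function.iterate_succ_apply']
    exact gamma_anti k (gamma_agree fun i hi => (iter_agree h _ i hi).symm)
      (gamma_anti k (iter_agree h _) ih)

theorem step {N : ℕ} (b : Fin N → ℕ) (k : Fin N)
    (h : ∀ i : Fin N, i.val < k.val → gamma^[2] b i = b i) :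
    ∃ t : ℕ, gamma^[2 * t + 2] b k = gamma^[2 * t] b k := by
  by_contra hne
  push Not at hne
  rcases le_total (b k) (gamma^[2] b k) with hk | hk
  · have key : ∀ t, t ≤ gamma^[2 * t] b k := by
      intro t
      induction t with
      | zero => exact Nat.zero_le _
      | succ t ih =>
        have h1 := iter_mono k (fun i hi => (h i hi).symm) hk t
        rw [← Function.iterate_add_apply] at h1
        have h2 := hne t
        have e : 2 * (t + 1) = 2 * t + 2 := by ring
        rw [e]
        omega
    have h1 := key (N + 1)
    have h2 := gamma_le (gamma^[2 * N + 1] b) k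
    rw [← Function.iterate_succ_apply' gamma] at h2
    have e : 2 * (N + 1) = (2 * N + 1).succ := by omega
    rw [e] at h1
    omega
  · have key : ∀ t, gamma^[2 * t] b k + t ≤ b k := by
      intro t
      induction t with
      | zero => exact le_refl _
      | succ t ih =>
        have h1 := iter_mono k h hk t
        rw [← Function.iterate_add_apply] at h1
        have h2 := hne t
        have e : 2 * (t + 1) = 2 * t + 2 := by ring
        rw [e]
        omega
    have h1 := key (b k + 1)
    omega

theorem initial_periodic {N : ℕ} (a : Fin N → ℕ) (k : ℕ) (hk : k ≤ N) :
    ∃ m : ℕ, ∀ i : Fin N, i.val < k → gamma^[m + 2] a i = gamma^[m] a i := by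
  induction k with
  | zero => exact ⟨0, fun i hi => absurd hi (Nat.not_lt_zero _)⟩
  | succ k ih =>
    obtain ⟨m, hm⟩ := ih (by omega)
    have hm' : ∀ i : Fin N, i.val < k → gamma^[2] (gamma^[m] a) i = gamma^[m] a i := by
      intro i hi
      rw [← Function.iterate_add_apply, Nat.add_comm 2 m]
      exact hm i hi
    obtain ⟨t, ht⟩ := step (gamma^[m] a) ⟨k, hk⟩ hm'
    refine ⟨2 * t + m, fun i hi => ?_⟩
    have e : 2 * t + m + 2 = (2 * t + 2) + m := by ring
    rw [e, Function.iterate_add_apply, Function.iterate_add_apply gamma (2 * t) m]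
    rcases Nat.lt_succ_iff_lt_or_eq.mp hi with h | h
    · rw [Function.iterate_add_apply gamma (2 * t) 2]
      exact iter_agree hm' _ i h
    · have : i = ⟨k, hk⟩ := Fin.ext h
      rw [this]
      exact ht

/-- For every admissible sequence `a = (a_0, …, a_n)`, repeated
application of `γ` eventually produces a double point: there exists `m ≥ 0` with
`γ^[m+2] a = γ^[m] a`. -/
theorem stmt16 (n : ℕ) (a : Fin (n + 1) → ℕ) (ha : ∀ i : Fin (n + 1), a i ≤ i) :
    ∃ m : ℕ, gamma^[m + 2] a = gamma^[m] a := by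
  obtain ⟨m, hm⟩ := initial_periodic a (n + 1) le_rfl
  exact ⟨m, funext fun i => hm i i.isLt⟩
end
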